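/- Fix d ≥ 1 and p ∈ (0,1). The limits lim_{t→∞} (log θ_t)/t and lim_{t→∞} (log χ_t)/t both exist in [−∞, ∞), they are equal, and moreover lim_{t→∞} (log θ_t)/t = sup_{t≥1} (log θ_t)/t and lim_{t→∞} (log χ_t)/t = inf_{t≥1} (log χ_t)/t. -/

import Mathlib

/-!
Common set-up: nearest-neighbour oriented bond percolation on the space-time
lattice `ℤ^d × ℕ`.  A (potential) bond is a pair `((x, s), y)`, representing
the oriented bond from `(x, s)` to `(y, s + 1)` (it is a genuine bond when
`‖x - y‖₁ = 1`).  Each bond is occupied (`true`) with probability `p`,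
independently of all other bonds.  The product Bernoulli(`p`) measure on
configurations is constructed explicitly as the pushforward of the uniform
measure on `[0,1)`: the binary digits of a uniform sample are i.i.d. fair
coin flips, which are re-packed (via the pairing function) into an i.i.d.
sequence of uniform random variables `unif i`, one for each bond, and the
bond indexed by `i` is occupied exactly when `unif i < p`.
-/

open MeasureTheory Filter Set
open scoped Classical ENNReal Topology

namespace OrientedPercolation

/-- A potential bond of the `d`-dimensional space-time lattice: `((x, s), y)`
represents the oriented pair from `(x, s)` to `(y, s + 1)`. -/
abbrev Bond (d : ℕ) := ((Fin d → ℤ) × ℕ) × (Fin d → ℤ)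

/-- A bond configuration: each potential bond is occupied (`true`) or vacant (`false`). -/
abbrev Config (d : ℕ) := Bond d → Bool

/-- The ℓ¹-norm of a point of `ℤ^d`. -/
def norm1 {d : ℕ} (x : Fin d → ℤ) : ℤ := ∑ i, |x i|

/-- The squared Euclidean norm of a point of `ℤ^d`. -/
def normSq {d : ℕ} (x : Fin d → ℤ) : ℤ := ∑ i, (x i) ^ 2

/-- The `n`-th binary digit of `x ∈ [0,1)`. -/
noncomputable def digit (n : ℕ) (x : ℝ) : ℕ := ⌊x * 2 ^ (n + 1)⌋.toNat % 2

/-- From a single uniform sample on `[0,1)`, an i.i.d. sequence of uniform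
samples on `[0,1]`, obtained by splitting the binary digits via the pairing
function. -/
noncomputable def unif (i : ℕ) (x : ℝ) : ℝ :=
  ∑' k : ℕ, (digit (Nat.pair i k) x : ℝ) / 2 ^ (k + 1)

/-- An injective encoding of the bonds by natural numbers. -/
noncomputable def enc (d : ℕ) : Bond d → ℕ := (exists_injective_nat (Bond d)).choose

/-- The i.i.d. Bernoulli(`p`) bond configuration built from a uniform sample `x`. -/
noncomputable def config (d : ℕ) (p : ℝ) (x : ℝ) : Config d :=
  fun b => if unif (enc d b) x < p then true else false

/-- The product Bernoulli(`p`) measure `ℙ_p` on bond configurations. -/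
noncomputable def P (d : ℕ) (p : ℝ) : Measure (Config d) :=
  Measure.map (config d p) ((volume : Measure ℝ).restrict (Set.Ico 0 1))

/-- `ConnectedIn ω R x s y t` : either `(x,s) = (y,t) ∈ R`, or there is a path of
occupied bonds from `(x, s)` to `(y, t)`, all of whose vertices lie in `R`. -/
def ConnectedIn {d : ℕ} (ω : Config d) (R : Set ((Fin d → ℤ) × ℕ))
    (x : Fin d → ℤ) (s : ℕ) (y : Fin d → ℤ) (t : ℕ) : Prop :=
  (x = y ∧ s = t ∧ (x, s) ∈ R) ∨
  (s < t ∧ ∃ v : ℕ → (Fin d → ℤ), v s = x ∧ v t = y ∧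
    (∀ j, s ≤ j → j ≤ t → (v j, j) ∈ R) ∧
    (∀ j, s ≤ j → j < t → norm1 (v (j + 1) - v j) = 1 ∧ ω ((v j, j), v (j + 1)) = true))

/-- `(x, s) → (y, t)` : `(x,s) = (y,t)` or there is a path of occupied bonds from
`(x, s)` to `(y, t)`. -/
def Connected {d : ℕ} (ω : Config d) (x : Fin d → ℤ) (s : ℕ) (y : Fin d → ℤ) (t : ℕ) : Prop :=
  ConnectedIn ω Set.univ x s y t

/-- The survival probability `θ_t = ℙ_p((o,0) → t)`. -/
noncomputable def theta (d : ℕ) (p : ℝ) (t : ℕ) : ℝ :=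
  (P d p {ω | ∃ y, Connected ω 0 0 y t}).toReal

/-- The two-point function `τ(x,t) = ℙ_p((o,0) → (x,t))`. -/
noncomputable def tau (d : ℕ) (p : ℝ) (x : Fin d → ℤ) (t : ℕ) : ℝ :=
  (P d p {ω | Connected ω 0 0 x t}).toReal

/-- The expected number of vertices at time `t` connected from the origin,
`χ_t = Σ_x τ(x,t)`. -/
noncomputable def chi (d : ℕ) (p : ℝ) (t : ℕ) : ℝ := ∑' x : Fin d → ℤ, tau d p x t

/-- The gyration radius `ξ_t = (χ_t⁻¹ Σ_x |x|² τ(x,t))^(1/2)`. -/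
noncomputable def xi (d : ℕ) (p : ℝ) (t : ℕ) : ℝ :=
  Real.sqrt ((∑' x : Fin d → ℤ, (normSq x : ℝ) * tau d p x t) / chi d p t)

/-- The critical point `p_c = inf {p ∈ [0,1] : θ_∞ > 0}` (here `θ_∞ = lim_t θ_t = inf_t θ_t`,
since `θ_t` is nonincreasing in `t` and nonnegative). -/
noncomputable def pc (d : ℕ) : ℝ :=
  sInf {p ∈ Set.Icc (0 : ℝ) 1 | 0 < ⨅ t : ℕ, theta d p t}

/-- The rectangle `[a, b] × [0, t]` (for `d = 1`). -/
def rect (a b : ℤ) (t : ℕ) : Set ((Fin 1 → ℤ) × ℕ) :=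
  {v | a ≤ v.1 0 ∧ v.1 0 ≤ b ∧ v.2 ≤ t}

/-- The rectangle `[a, b] × [0, t]` is crossed vertically: there is a path of occupied
bonds inside the rectangle from some vertex `(x, 0)` to some vertex `(y, t)`. -/
def CrossedVert (ω : Config 1) (a b : ℤ) (t : ℕ) : Prop :=
  ∃ x y : Fin 1 → ℤ, ConnectedIn ω (rect a b t) x 0 y t

/-- The rectangle `[a, b] × [0, t]` is crossed from left to right: there is a path of
occupied bonds inside the rectangle containing a vertex with first coordinate `a` and
a vertex with first coordinate `b`. -/
def CrossedHoriz (ω : Config 1) (a b : ℤ) (t : ℕ) : Prop :=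
  ∃ (x y : Fin 1 → ℤ) (s u : ℕ), x 0 = a ∧ y 0 = b ∧
    (ConnectedIn ω (rect a b t) x s y u ∨ ConnectedIn ω (rect a b t) y u x s)

/-- `V_p(w, t) = ℙ_p([0,w] × [0,t] is crossed vertically)`. -/
noncomputable def V (p : ℝ) (w : ℕ) (t : ℕ) : ℝ :=
  (P 1 p {ω | CrossedVert ω 0 w t}).toReal

/-- `H_p(w, t) = ℙ_p([0,w] × [0,t] is crossed from left to right)`. -/
noncomputable def H (p : ℝ) (w : ℕ) (t : ℕ) : ℝ :=
  (P 1 p {ω | CrossedHoriz ω 0 w t}).toReal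

/-- The event that `(o, 0)` is connected, inside the box `B_o = [-w,w] × [0,t]`, to the
boundary `∂B_o = {(x,s) ∈ B_o : s = t or |x| = w}`. -/
def ToBoundary (ω : Config 1) (w : ℕ) (t : ℕ) : Prop :=
  ∃ (y : Fin 1 → ℤ) (s : ℕ), (s = t ∨ |y 0| = w) ∧
    ConnectedIn ω (rect (-(w : ℤ)) w t) 0 0 y s

noncomputable def coin : Measure ℕ := (2⁻¹ : ℝ≥0∞) • (Measure.dirac 0 + Measure.dirac 1)

lemma coin_apply (t : Set ℕ) :
    coin t = 2⁻¹ * ((if 0 ∈ t then 1 else 0) + (if 1 ∈ t then 1 else 0)) := by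
  simp [coin, Set.indicator_apply, mul_add]

instance : IsProbabilityMeasure coin := ⟨by
  rw [coin_apply]; simp [one_add_one_eq_two]
  exact ENNReal.inv_mul_cancel (by simp) (by simp)⟩

lemma measurable_digit (n : ℕ) : Measurable (digit n) := by
  unfold digit
  have h : Measurable (fun z : ℤ => z.toNat % 2) := measurable_from_top
  exact h.comp (Int.measurable_floor.comp (measurable_id.mul_const _))

lemma digit_le (n : ℕ) (x : ℝ) : digit n x ≤ 1 := by unfold digit; omega

lemma digit_succ (n : ℕ) (x : ℝ) : digit (n + 1) x = digit n (2 * x) := by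
  unfold digit
  congr 3; ring

lemma digit_succ' (n : ℕ) (x : ℝ) (hx : 0 ≤ 2 * x - 1) : digit (n + 1) x = digit n (2 * x - 1) := by
  rw [digit_succ]
  unfold digit
  have h1 : (2 * x) * 2 ^ (n + 1) = (2 * x - 1) * 2 ^ (n + 1) + ((2 ^ (n + 1) : ℤ) : ℝ) := by
    push_cast; ring
  rw [h1, Int.floor_add_intCast]
  have h2 : 0 ≤ ⌊(2 * x - 1) * 2 ^ (n + 1)⌋ := Int.floor_nonneg.2 (by positivity)
  have h3 : (2 : ℤ) ^ (n + 1) = 2 * 2 ^ n := by ring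
  have h4 : (0:ℤ) < 2 ^ n := by positivity
  omega

lemma digit_zero_of_lt (x : ℝ) (h0 : 0 ≤ x) (hx : 2 * x < 1) : digit 0 x = 0 := by
  unfold digit
  have : ⌊x * 2 ^ (0 + 1)⌋ = 0 := by
    rw [Int.floor_eq_iff]; constructor <;> push_cast <;> linarith
  rw [this]; rfl

lemma digit_zero_of_ge (x : ℝ) (h0 : 1 ≤ 2 * x) (hx : x < 1) : digit 0 x = 1 := by
  unfold digit
  have : ⌊x * 2 ^ (0 + 1)⌋ = 1 := by
    rw [Int.floor_eq_iff]; constructor <;> push_cast <;> linarith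
  rw [this]; rfl

lemma digit_cyl (n : ℕ) : ∀ (t : ℕ → Set ℕ),
    volume ({x : ℝ | ∀ i < n, digit i x ∈ t i} ∩ Ico 0 1) = ∏ i ∈ Finset.range n, coin (t i) := by
  induction n with
  | zero => intro t; simp
  | succ n ih =>
    intro t
    set A : Set ℝ := {x : ℝ | ∀ i < n, digit i x ∈ t (i + 1)} ∩ Ico 0 1 with hA
    have hAm : MeasurableSet A := by
      refine MeasurableSet.inter ?_ measurableSet_Ico
      have : {x : ℝ | ∀ i < n, digit i x ∈ t (i + 1)} =
          ⋂ i, ⋂ (_ : i < n), digit i ⁻¹' (t (i + 1)) := by ext; simp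
      rw [this]
      exact MeasurableSet.iInter fun i => MeasurableSet.iInter fun _ =>
        measurable_digit i (MeasurableSet.of_discrete)
    have hv : volume A = ∏ i ∈ Finset.range n, coin (t (i + 1)) := ih fun i => t (i + 1)
    have hB : volume ((fun x : ℝ => 2 * x) ⁻¹' A) = 2⁻¹ * volume A := by
      rw [Real.volume_preimage_mul_left (by norm_num)]
      congr 1
      rw [abs_of_pos (by norm_num), ENNReal.ofReal_inv_of_pos (by norm_num)]; simp
    have hC : volume ((fun x : ℝ => 2 * x - 1) ⁻¹' A) = 2⁻¹ * volume A := by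
      have : (fun x : ℝ => 2 * x - 1) ⁻¹' A = (fun x : ℝ => 2 * x) ⁻¹' ((fun x => x + (-1)) ⁻¹' A) := by
        ext x; simp [sub_eq_add_neg]
      rw [this, Real.volume_preimage_mul_left (by norm_num), measure_preimage_add_right]
      congr 1
      rw [abs_of_pos (by norm_num), ENNReal.ofReal_inv_of_pos (by norm_num)]; simp
    have hE : {x : ℝ | ∀ i < n + 1, digit i x ∈ t i} ∩ Ico 0 1 =
        (if 0 ∈ t 0 then (fun x : ℝ => 2 * x) ⁻¹' A else ∅) ∪
        (if 1 ∈ t 0 then (fun x : ℝ => 2 * x - 1) ⁻¹' A else ∅) := by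
      ext x
      have key : (x ∈ {x : ℝ | ∀ i < n + 1, digit i x ∈ t i} ∩ Ico 0 1) ↔
          (digit 0 x ∈ t 0 ∧ (∀ i < n, digit (i + 1) x ∈ t (i + 1))) ∧ 0 ≤ x ∧ x < 1 := by
        simp only [Set.mem_inter_iff, Set.mem_ofPred_eq, Set.mem_Ico]
        refine and_congr_left fun _ => ⟨fun h => ⟨h 0 (by omega), fun i hi => h _ (by omega)⟩, ?_⟩
        rintro ⟨h0, h1⟩ i hi
        cases i with
        | zero => exact h0
        | succ i => exact h1 i (by omega)
      rw [key]
      have e1 : x ∈ (if 0 ∈ t 0 then (fun x : ℝ => 2 * x) ⁻¹' A else ∅) ↔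
          0 ∈ t 0 ∧ (∀ i < n, digit i (2 * x) ∈ t (i + 1)) ∧ 0 ≤ 2 * x ∧ 2 * x < 1 := by
        split_ifs with h
        · simp only [h, hA, true_and]; rfl
        · simp [h]
      have e2 : x ∈ (if 1 ∈ t 0 then (fun x : ℝ => 2 * x - 1) ⁻¹' A else ∅) ↔
          1 ∈ t 0 ∧ (∀ i < n, digit i (2 * x - 1) ∈ t (i + 1)) ∧ 0 ≤ 2 * x - 1 ∧ 2 * x - 1 < 1 := by
        split_ifs with h
        · simp only [h, hA, true_and]; rfl
        · simp [h]
      rw [Set.mem_union, e1, e2]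
      constructor
      · rintro ⟨⟨h0, h1⟩, h2, h3⟩
        rcases lt_or_ge (2 * x) 1 with h | h
        · left
          rw [digit_zero_of_lt x h2 h] at h0
          exact ⟨h0, fun i hi => digit_succ i x ▸ h1 i hi, by linarith, h⟩
        · right
          rw [digit_zero_of_ge x h h3] at h0
          exact ⟨h0, fun i hi => digit_succ' i x (by linarith) ▸ h1 i hi, by linarith, by linarith⟩
      · rintro (⟨h0, h1, h2, h3⟩ | ⟨h0, h1, h2, h3⟩)
        · refine ⟨⟨?_, fun i hi => ?_⟩, by linarith, by linarith⟩
          · rw [digit_zero_of_lt x (by linarith) h3]; exact h0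
          · rw [digit_succ]; exact h1 i hi
        · refine ⟨⟨?_, fun i hi => ?_⟩, by linarith, by linarith⟩
          · rw [digit_zero_of_ge x (by linarith) (by linarith)]; exact h0
          · rw [digit_succ' i x h2]; exact h1 i hi
    have hmC : MeasurableSet ((fun x : ℝ => 2 * x - 1) ⁻¹' A) :=
      ((measurable_const.mul measurable_id).sub_const 1) hAm
    rw [hE, measure_union, Finset.prod_range_succ', ← hv, coin_apply]
    · split_ifs <;> simp [hB, hC] <;> ring
    · rw [Set.disjoint_left]
      intro x h1 h2
      have h1' : x ∈ (fun x : ℝ => 2 * x) ⁻¹' A := by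
        split_ifs at h1 <;> first | exact h1 | exact absurd h1 (by simp)
      have h2' : x ∈ (fun x : ℝ => 2 * x - 1) ⁻¹' A := by
        split_ifs at h2 <;> first | exact h2 | exact absurd h2 (by simp)
      have a := h1'.2.2
      have b := h2'.2.1
      simp only at a b
      linarith
    · split_ifs
      · exact hmC
      · exact MeasurableSet.empty

lemma map_digit :
    ((volume : Measure ℝ).restrict (Ico 0 1)).map (fun x n => digit n x) =
      Measure.infinitePi (fun _ : ℕ => coin) := by
  refine Measure.eq_infinitePi _ fun s t ht => ?_
  have hm : Measurable (fun x n => digit n x : ℝ → ℕ → ℕ) := measurable_pi_lambda _ measurable_digit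
  rw [Measure.map_apply hm (MeasurableSet.pi s.countable_toSet fun i _ => ht i),
    Measure.restrict_apply (hm (MeasurableSet.pi s.countable_toSet fun i _ => ht i))]
  have hs : ∀ i ∈ s, i < s.sup id + 1 := fun i hi => Nat.lt_succ_of_le (Finset.le_sup (f := id) hi)
  have := digit_cyl (s.sup id + 1) (fun i => if i ∈ s then t i else Set.univ)
  convert this using 1
  · congr 2
    ext x
    simp only [Set.mem_preimage, Set.mem_pi, Set.mem_ofPred_eq, Finset.mem_coe]
    constructor
    · intro h i _
      split_ifs with hi
      · exact h i hi
      · trivial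
    · intro h i hi
      have := h i (hs i hi)
      rwa [if_pos hi] at this
  · have : s ⊆ Finset.range (s.sup id + 1) := fun i hi => Finset.mem_range.2 (hs i hi)
    rw [← Finset.prod_subset this]
    · exact Finset.prod_congr rfl fun i hi => by rw [if_pos hi]
    · intro i _ hi
      rw [if_neg hi, measure_univ]

/-- binary sum -/
noncomputable def bsum (c : ℕ → ℕ) : ℝ := ∑' k : ℕ, (c k : ℝ) / 2 ^ (k + 1)

lemma measurable_bsum : Measurable bsum := by
  have : bsum = fun c => (∑' k : ℕ, ((c k : ℝ≥0∞) / 2 ^ (k + 1))).toReal := by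
    ext c
    rw [ENNReal.tsum_toReal_eq]
    · simp [bsum]
    · intro k
      exact ENNReal.div_ne_top (by simp) (by simp)
  rw [this]
  refine Measurable.ennreal_toReal (Measurable.tsum fun k => ?_)
  refine Measurable.div_const ?_ _
  have : Measurable (fun n : ℕ => (n : ℝ≥0∞)) := measurable_from_top
  exact this.comp (measurable_pi_apply k)

lemma partial_le (n : ℕ) : ∀ x : ℝ, x ∈ Ico (0:ℝ) 1 →
    ∑ k ∈ Finset.range n, (digit k x : ℝ) / 2 ^ (k + 1) ≤ x := by
  induction n with
  | zero => intro x hx; simpa using hx.1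
  | succ n ih =>
    intro x hx
    rw [Finset.sum_range_succ']
    rcases lt_or_ge (2 * x) 1 with h | h
    · have := ih (2 * x) ⟨by linarith [hx.1], h⟩
      rw [digit_zero_of_lt x hx.1 h]
      have e : ∑ k ∈ Finset.range n, (digit (k + 1) x : ℝ) / 2 ^ (k + 1 + 1) =
        (∑ k ∈ Finset.range n, (digit k (2 * x) : ℝ) / 2 ^ (k + 1)) / 2 := by
        rw [Finset.sum_div]
        refine Finset.sum_congr rfl fun k _ => ?_
        rw [digit_succ, pow_succ _ (k + 1), div_div]
      rw [e]; simp; linarith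
    · have := ih (2 * x - 1) ⟨by linarith [hx.1], by linarith [hx.2]⟩
      rw [digit_zero_of_ge x h hx.2]
      have e : ∑ k ∈ Finset.range n, (digit (k + 1) x : ℝ) / 2 ^ (k + 1 + 1) =
        (∑ k ∈ Finset.range n, (digit k (2 * x - 1) : ℝ) / 2 ^ (k + 1)) / 2 := by
        rw [Finset.sum_div]
        refine Finset.sum_congr rfl fun k _ => ?_
        rw [digit_succ' _ _ (by linarith), pow_succ _ (k + 1), div_div]
      rw [e]; simp; linarith

lemma bsum_digit_le (x : ℝ) (hx : x ∈ Ico (0:ℝ) 1) : bsum (fun n => digit n x) ≤ x :=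
  Real.tsum_le_of_sum_range_le (fun n => by positivity) fun n => partial_le n x hx

/-- law of a single bond -/
noncomputable def bern (p : ℝ) : Measure Bool :=
  (Measure.infinitePi (fun _ : ℕ => coin)).map (fun c => if bsum c < p then true else false)

lemma measurable_thr (p : ℝ) : Measurable (fun c => if bsum c < p then true else false) :=
  Measurable.ite (measurableSet_lt measurable_bsum measurable_const) measurable_const measurable_const

instance (p : ℝ) : IsProbabilityMeasure (bern p) :=
  Measure.isProbabilityMeasure_map (measurable_thr p).aemeasurable

lemma bern_pos (p : ℝ) (hp : p ∈ Ioo (0:ℝ) 1) : 0 < bern p {true} := by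
  have hm : Measurable (fun x n => digit n x : ℝ → ℕ → ℕ) := measurable_pi_lambda _ measurable_digit
  rw [bern, ← map_digit, Measure.map_map (measurable_thr p) hm,
    Measure.map_apply ((measurable_thr p).comp hm) (by simp),
    Measure.restrict_apply (((measurable_thr p).comp hm) (by simp))]
  have : Ico 0 p ⊆ ((fun c => if bsum c < p then true else false) ∘ fun (x:ℝ) n => digit n x) ⁻¹' {true} ∩ Ico 0 1 := by
    intro x hx
    have h1 : x ∈ Ico (0:ℝ) 1 := ⟨hx.1, hx.2.trans hp.2⟩
    refine ⟨?_, h1⟩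
    simpa using (bsum_digit_le x h1).trans_lt hx.2
  refine lt_of_lt_of_le ?_ (measure_mono this)
  simpa using hp.1

lemma enc_injective (d : ℕ) : Function.Injective (enc d) := (exists_injective_nat (Bond d)).choose_spec

lemma P_eq (d : ℕ) (p : ℝ) : P d p = Measure.infinitePi (fun _ : Bond d => bern p) := by
  have hm : Measurable (fun x n => digit n x : ℝ → ℕ → ℕ) := measurable_pi_lambda _ measurable_digit
  have h1 := Measure.map_infinitePi_infinitePi_of_inj (P := fun _ : ℕ => coin)
    (f := fun q : ℕ × ℕ => Nat.pair q.1 q.2) (fun a b h => by simpa [Prod.ext_iff] using h)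
  have h2 := Measure.infinitePi_map_curry (fun (_ : ℕ) (_ : ℕ) => coin)
  have h3 := Measure.infinitePi_map_pi (fun _ : ℕ => Measure.infinitePi (fun _ : ℕ => coin))
    (f := fun _ c => if bsum c < p then true else false) (fun _ => measurable_thr p)
  have h4 := Measure.map_infinitePi_infinitePi_of_inj (P := fun _ : ℕ => bern p)
    (f := enc d) (enc_injective d)
  have m3 : Measurable (fun (x : ℕ → ℕ → ℕ) (i : ℕ) => if bsum (x i) < p then true else false) :=
    measurable_pi_lambda _ fun i => (measurable_thr p).comp (measurable_pi_apply i)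
  rw [← h4]
  simp only [bern] at h3 ⊢
  rw [← h3, ← h2, ← h1, ← map_digit, Measure.map_map (by fun_prop) hm,
    Measure.map_map (by fun_prop) ((by fun_prop : Measurable
      (fun (ω : ℕ → ℕ) (i : ℕ × ℕ) => ω (Nat.pair i.1 i.2))).comp hm),
    Measure.map_map m3 ((by fun_prop : Measurable (MeasurableEquiv.curry ℕ ℕ ℕ)).comp
      ((by fun_prop : Measurable
      (fun (ω : ℕ → ℕ) (i : ℕ × ℕ) => ω (Nat.pair i.1 i.2))).comp hm)),
    Measure.map_map (by fun_prop) (m3.comp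
      ((by fun_prop : Measurable (MeasurableEquiv.curry ℕ ℕ ℕ)).comp
      ((by fun_prop : Measurable
      (fun (ω : ℕ → ℕ) (i : ℕ × ℕ) => ω (Nat.pair i.1 i.2))).comp hm)))]
  rfl

instance (d : ℕ) (p : ℝ) : IsProbabilityMeasure (P d p) := by rw [P_eq]; infer_instance

lemma conn_self {d : ℕ} (ω : Config d) (x : Fin d → ℤ) (s : ℕ) (y : Fin d → ℤ) :
    Connected ω x s y s ↔ x = y := by
  simp [Connected, ConnectedIn]

lemma conn_succ {d : ℕ} (ω : Config d) (x : Fin d → ℤ) (s : ℕ) (y : Fin d → ℤ) (t : ℕ)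
    (hst : s ≤ t) :
    Connected ω x s y (t + 1) ↔
      ∃ z, Connected ω x s z t ∧ norm1 (y - z) = 1 ∧ ω ((z, t), y) = true := by
  constructor
  · rintro (⟨_, h, _⟩ | ⟨_, v, h1, h2, _, h3⟩)
    · omega
    · refine ⟨v t, ?_, ?_⟩
      · rcases hst.eq_or_lt with rfl | h
        · exact Or.inl ⟨h1.symm, rfl, trivial⟩
        · exact Or.inr ⟨h, v, h1, rfl, fun _ _ _ => trivial, fun j hj hj' => h3 j hj (by omega)⟩
      · rw [← h2]; exact h3 t hst (by omega)
  · rintro ⟨z, h, hn, ho⟩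
    refine Or.inr ⟨by omega, ?_⟩
    rcases h with ⟨rfl, rfl, _⟩ | ⟨hlt, v, h1, h2, _, h3⟩
    · refine ⟨fun j => if j = s then x else y, by simp, by simp, fun _ _ _ => trivial, ?_⟩
      intro j hj hj'
      obtain rfl : j = s := by omega
      simpa using ⟨hn, ho⟩
    · refine ⟨fun j => if j ≤ t then v j else y, by simp [hst, h1], by simp,
        fun _ _ _ => trivial, ?_⟩
      intro j hj hj'
      rcases (Nat.lt_succ_iff.1 hj').eq_or_lt with rfl | h
      · simpa [h2] using ⟨hn, ho⟩
      · have a : j ≤ t := h.le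
        have b : j + 1 ≤ t := h
        simpa [a, b] using h3 j hj h

lemma conn_trans {d : ℕ} (ω : Config d) (x : Fin d → ℤ) (s r : ℕ) (hsr : s ≤ r) (t : ℕ)
    (hrt : r ≤ t) : ∀ y : Fin d → ℤ,
    Connected ω x s y t ↔ ∃ z, Connected ω x s z r ∧ Connected ω z r y t := by
  induction t, hrt using Nat.le_induction with
  | base => intro y; simp [conn_self]
  | succ t hrt ih =>
    intro y
    rw [conn_succ _ _ _ _ _ (hsr.trans hrt)]
    simp only [conn_succ _ _ _ _ _ hrt, ih]
    constructor
    · rintro ⟨z, ⟨w, h1, h2⟩, h3⟩; exact ⟨w, h1, z, h2, h3⟩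
    · rintro ⟨w, h1, z, h2, h3⟩; exact ⟨z, ⟨w, h1, h2⟩, h3⟩

/-- space-time shift -/
def sh {d : ℕ} (a : Fin d → ℤ) (u : ℕ) (ω : Config d) : Config d :=
  fun b => ω ((b.1.1 + a, b.1.2 + u), b.2 + a)

lemma measurable_sh {d : ℕ} (a : Fin d → ℤ) (u : ℕ) : Measurable (sh a u) :=
  measurable_pi_lambda _ fun _ => measurable_pi_apply _

lemma map_sh {d : ℕ} (p : ℝ) (a : Fin d → ℤ) (u : ℕ) : (P d p).map (sh a u) = P d p := by
  rw [P_eq]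
  refine Measure.map_infinitePi_infinitePi_of_inj (P := fun _ : Bond d => bern p)
    (f := fun b : Bond d => (((b.1.1 + a, b.1.2 + u), b.2 + a) : Bond d)) ?_
  rintro ⟨⟨x, s⟩, y⟩ ⟨⟨x', s'⟩, y'⟩ h
  simpa using h

lemma conn_sh {d : ℕ} (ω : Config d) (a : Fin d → ℤ) (u : ℕ) (x : Fin d → ℤ) (s : ℕ) (t : ℕ)
    (hst : s ≤ t) : ∀ y,
    Connected (sh a u ω) x s y t ↔ Connected ω (x + a) (s + u) (y + a) (t + u) := by
  induction t, hst using Nat.le_induction with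
  | base => intro y; simp [conn_self]
  | succ t hst ih =>
    intro y
    rw [conn_succ _ _ _ _ _ hst, show t + 1 + u = (t + u) + 1 by ring,
      conn_succ _ _ _ _ _ (by omega)]
    simp only [ih, sh]
    constructor
    · rintro ⟨z, h1, h2, h3⟩
      exact ⟨z + a, h1, by simpa using h2, h3⟩
    · rintro ⟨z, h1, h2, h3⟩
      refine ⟨z - a, by simpa using h1, ?_, by simpa using h3⟩
      rw [← h2]; congr 1; abel

/-- the sigma-algebra generated by the bonds in `S` -/
abbrev sig (d : ℕ) (S : Set (Bond d)) : MeasurableSpace (Config d) :=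
  ⨆ b ∈ S, MeasurableSpace.comap (fun ω : Config d => ω b) inferInstance

lemma sig_le (d : ℕ) (S : Set (Bond d)) : sig d S ≤ MeasurableSpace.pi :=
  iSup₂_le fun b _ => (measurable_pi_apply b).comap_le

lemma meas_bond {d : ℕ} (S : Set (Bond d)) (b : Bond d) (hb : b ∈ S) :
    MeasurableSet[sig d S] {ω | ω b = true} := by
  have h : MeasurableSpace.comap (fun ω : Config d => ω b) inferInstance ≤ sig d S :=
    le_iSup₂_of_le b hb le_rfl
  exact h _ ⟨{true}, by simp, rfl⟩

lemma meas_conn {d : ℕ} (S : Set (Bond d)) (x : Fin d → ℤ) (s t : ℕ) (hst : s ≤ t) :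
    (∀ b : Bond d, s ≤ b.1.2 → b.1.2 < t → b ∈ S) → ∀ y,
    MeasurableSet[sig d S] {ω | Connected ω x s y t} := by
  induction t, hst using Nat.le_induction with
  | base => intro _ y; simp only [conn_self]; exact MeasurableSet.const _
  | succ t hst ih =>
    intro hS y
    have : {ω | Connected ω x s y (t + 1)} =
        ⋃ z, ({ω | Connected ω x s z t} ∩ ({_ω : Config d | norm1 (y - z) = 1} ∩
          {ω | ω ((z, t), y) = true})) := by
      ext ω
      simp [conn_succ _ _ _ _ _ hst]
    rw [this]
    refine MeasurableSet.iUnion fun z => ?_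
    refine MeasurableSet.inter (ih (fun b h1 h2 => hS b h1 (by omega)) z) ?_
    exact MeasurableSet.inter (MeasurableSet.const _) (meas_bond S _ (hS _ hst (by simp)))

lemma meas_surv {d : ℕ} (S : Set (Bond d)) (x : Fin d → ℤ) (s t : ℕ) (hst : s ≤ t)
    (h : ∀ b : Bond d, s ≤ b.1.2 → b.1.2 < t → b ∈ S) :
    MeasurableSet[sig d S] {ω | ∃ y, Connected ω x s y t} := by
  have : {ω | ∃ y, Connected ω x s y t} = ⋃ y, {ω | Connected ω x s y t} := by ext; simp
  rw [this]
  exact MeasurableSet.iUnion fun y => meas_conn S x s t hst h y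

lemma indep_sig {d : ℕ} (p : ℝ) (S T : Set (Bond d)) (h : Disjoint S T) (A B : Set (Config d))
    (hA : MeasurableSet[sig d S] A) (hB : MeasurableSet[sig d T] B) :
    P d p (A ∩ B) = P d p A * P d p B := by
  have h1 : ProbabilityTheory.iIndepFun (fun (b : Bond d) (ω : Config d) => ω b) (P d p) := by
    rw [P_eq]
    exact ProbabilityTheory.iIndepFun_infinitePi (X := fun _ b => b) (fun _ => measurable_id)
  have h2 := ProbabilityTheory.indep_iSup_of_disjoint
    (fun b => (measurable_pi_apply b).comap_le) h1.iIndep h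
  exact (ProbabilityTheory.Indep_iff _ _ _).1 h2 A B hA hB

/-- survival probability, extended -/
noncomputable def Th (d : ℕ) (p : ℝ) (t : ℕ) : ℝ≥0∞ := P d p {ω | ∃ y, Connected ω 0 0 y t}

noncomputable def Ta (d : ℕ) (p : ℝ) (x : Fin d → ℤ) (t : ℕ) : ℝ≥0∞ :=
  P d p {ω | Connected ω 0 0 x t}

noncomputable def Ch (d : ℕ) (p : ℝ) (t : ℕ) : ℝ≥0∞ := ∑' x, Ta d p x t

lemma Ta_shift (d : ℕ) (p : ℝ) (x y : Fin d → ℤ) (s t : ℕ) :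
    P d p {ω | Connected ω x s y (s + t)} = Ta d p (y - x) t := by
  have h := Measure.map_apply (μ := P d p) (measurable_sh x s)
    (sig_le d univ _ (meas_conn _ 0 0 t (Nat.zero_le t) (fun _ _ _ => trivial) (y - x)))
  rw [map_sh] at h
  rw [Ta, h]
  congr 1
  ext ω
  simp [conn_sh _ _ _ _ _ _ (Nat.zero_le t), add_comm]

lemma Th_shift (d : ℕ) (p : ℝ) (x : Fin d → ℤ) (s t : ℕ) :
    P d p {ω | ∃ y, Connected ω x s y (s + t)} = Th d p t := by
  have h := Measure.map_apply (μ := P d p) (measurable_sh x s)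
    (sig_le d univ _ (meas_surv _ 0 0 t (Nat.zero_le t) (fun _ _ _ => trivial)))
  rw [map_sh] at h
  rw [Th, h]
  congr 1
  ext ω
  simp only [Set.mem_ofPred_eq, Set.mem_preimage, conn_sh _ _ _ _ _ _ (Nat.zero_le t), zero_add,
    add_comm t s]
  exact ⟨fun ⟨y, h⟩ => ⟨y - x, by simpa using h⟩, fun ⟨y, h⟩ => ⟨y + x, h⟩⟩

lemma disj_time (d : ℕ) (s : ℕ) : Disjoint {b : Bond d | b.1.2 < s} {b : Bond d | s ≤ b.1.2} := by
  rw [Set.disjoint_left]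
  intro b h1 h2
  simp only [Set.mem_ofPred_eq] at h1 h2
  omega

lemma Ta_sub (d : ℕ) (p : ℝ) (y : Fin d → ℤ) (s t : ℕ) :
    Ta d p y (s + t) ≤ ∑' z, Ta d p z s * Ta d p (y - z) t := by
  have e : {ω | Connected ω 0 0 y (s + t)} =
      ⋃ z, ({ω : Config d | Connected ω 0 0 z s} ∩ {ω | Connected ω z s y (s + t)}) := by
    ext ω
    simp [conn_trans ω 0 0 s (Nat.zero_le s) (s + t) (by omega) y]
  rw [Ta, e]
  refine (measure_iUnion_le _).trans (ENNReal.tsum_le_tsum fun z => ?_)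
  rw [indep_sig p _ _ (disj_time d s)
    _ _ (meas_conn _ _ _ _ (Nat.zero_le s) (fun b _ h => h) _)
    (meas_conn _ _ _ _ (by omega) (fun b h _ => h) _), Ta_shift]
  rfl

lemma Ch_sub (d : ℕ) (p : ℝ) (s t : ℕ) : Ch d p (s + t) ≤ Ch d p s * Ch d p t := by
  calc Ch d p (s + t) ≤ ∑' y, ∑' z, Ta d p z s * Ta d p (y - z) t :=
        ENNReal.tsum_le_tsum fun y => Ta_sub d p y s t
    _ = ∑' z, ∑' y, Ta d p z s * Ta d p (y - z) t := ENNReal.tsum_comm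
    _ = ∑' z, Ta d p z s * Ch d p t := by
        refine tsum_congr fun z => ?_
        rw [ENNReal.tsum_mul_left]
        congr 1
        exact (Equiv.subRight z).tsum_eq (fun y => Ta d p y t)
    _ = Ch d p s * Ch d p t := by rw [ENNReal.tsum_mul_right]; rfl

lemma Th_super (d : ℕ) (p : ℝ) (s t : ℕ) : Th d p s * Th d p t ≤ Th d p (s + t) := by
  obtain ⟨f, hf⟩ := exists_surjective_nat (Fin d → ℤ)
  set A : ℕ → Set (Config d) := fun n => {ω | Connected ω 0 0 (f n) s}
  set B : ℕ → Set (Config d) := fun n => {ω | ∃ y, Connected ω (f n) s y (s + t)}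
  have hA : ∀ n, MeasurableSet[sig d {b : Bond d | b.1.2 < s}] (A n) := fun n =>
    meas_conn _ _ _ _ (Nat.zero_le s) (fun b _ h => h) _
  have hB : ∀ n, MeasurableSet[sig d {b : Bond d | s ≤ b.1.2}] (B n) := fun n =>
    meas_surv _ _ _ _ (by omega) (fun b h _ => h)
  have hD : ∀ n, MeasurableSet[sig d {b : Bond d | b.1.2 < s}] (disjointed A n) := fun n =>
    MeasurableSet.disjointed hA n
  have e : {ω | ∃ y, Connected ω 0 0 y s} = ⋃ n, disjointed A n := by
    rw [iUnion_disjointed]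
    ext ω
    simp only [Set.mem_ofPred_eq, Set.mem_iUnion, A]
    exact hf.exists
  have hsub : (⋃ n, (disjointed A n ∩ B n)) ⊆ {ω | ∃ y, Connected ω 0 0 y (s + t)} := by
    intro ω hω
    obtain ⟨n, h1, y, h2⟩ := Set.mem_iUnion.1 hω
    exact ⟨y, (conn_trans ω 0 0 s (Nat.zero_le s) (s + t) (by omega) y).2
      ⟨f n, disjointed_subset A n h1, h2⟩⟩
  calc Th d p s * Th d p t = (∑' n, P d p (disjointed A n)) * Th d p t := by
        congr 1
        rw [Th, e, measure_iUnion (disjoint_disjointed A) (fun n => sig_le _ _ _ (hD n))]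
    _ = ∑' n, P d p (disjointed A n ∩ B n) := by
        rw [← ENNReal.tsum_mul_right]
        refine tsum_congr fun n => ?_
        rw [indep_sig p _ _ (disj_time d s) _ _ (hD n) (hB n), Th_shift]
    _ = P d p (⋃ n, (disjointed A n ∩ B n)) := by
        rw [measure_iUnion]
        · intro i j hij
          exact (disjoint_disjointed A hij).mono Set.inter_subset_left Set.inter_subset_left
        · exact fun n => (sig_le _ _ _ (hD n)).inter (sig_le _ _ _ (hB n))
    _ ≤ Th d p (s + t) := measure_mono hsub

lemma Ta_le_Th (d : ℕ) (p : ℝ) (x : Fin d → ℤ) (t : ℕ) : Ta d p x t ≤ Th d p t :=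
  measure_mono fun _ h => ⟨x, h⟩

lemma Th_le_Ch (d : ℕ) (p : ℝ) (t : ℕ) : Th d p t ≤ Ch d p t := by
  have : {ω | ∃ y, Connected ω 0 0 y t} = ⋃ y, {ω : Config d | Connected ω 0 0 y t} := by
    ext; simp
  rw [Th, this]
  exact measure_iUnion_le _

lemma Th_le_one (d : ℕ) (p : ℝ) (t : ℕ) : Th d p t ≤ 1 := prob_le_one

lemma conn_bound {d : ℕ} (ω : Config d) (t : ℕ) : ∀ x : Fin d → ℤ, Connected ω 0 0 x t →
    ∀ i, |x i| ≤ t := by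
  induction t with
  | zero => intro x h i; rw [conn_self] at h; simp [← h]
  | succ t ih =>
    intro x h i
    obtain ⟨z, h1, h2, _⟩ := (conn_succ _ _ _ _ _ (Nat.zero_le t)).1 h
    have a := ih z h1 i
    have b : |(x - z) i| ≤ norm1 (x - z) :=
      Finset.single_le_sum (f := fun i => |(x - z) i|) (fun _ _ => abs_nonneg _) (Finset.mem_univ i)
    rw [h2, Pi.sub_apply] at b
    have c := abs_add_le (z i) (x i - z i)
    rw [add_sub_cancel] at c
    push_cast
    linarith

lemma Ch_le (d : ℕ) (p : ℝ) (t : ℕ) : Ch d p t ≤ (2 * t + 1 : ℝ≥0∞) ^ d * Th d p t := by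
  set F : Finset (Fin d → ℤ) := Fintype.piFinset (fun _ => Finset.Icc (-(t : ℤ)) t)
  have hF : ∀ x ∉ F, Ta d p x t = 0 := by
    intro x hx
    have : {ω : Config d | Connected ω 0 0 x t} = ∅ := by
      ext ω
      simp only [Set.mem_ofPred_eq, Set.mem_empty_iff_false, iff_false]
      intro h
      refine hx (Fintype.mem_piFinset.2 fun i => ?_)
      rw [Finset.mem_Icc]
      exact abs_le.1 (conn_bound ω t x h i)
    rw [Ta, this, measure_empty]
  rw [Ch, tsum_eq_sum (fun x hx => hF x hx)]
  refine (Finset.sum_le_card_nsmul _ _ _ fun x _ => Ta_le_Th d p x t).trans ?_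
  rw [nsmul_eq_mul]
  have hc : F.card = (2 * t + 1) ^ d := by
    simp only [F, Fintype.card_piFinset, Int.card_Icc, Finset.prod_const, Finset.card_univ,
      Fintype.card_fin]
    congr 1; omega
  rw [hc]; push_cast; rfl

lemma Th_one_pos (d : ℕ) (hd : 1 ≤ d) (p : ℝ) (hp : p ∈ Ioo (0:ℝ) 1) : 0 < Th d p 1 := by
  set e : Fin d → ℤ := Pi.single ⟨0, hd⟩ 1 with he
  have hn : norm1 e = 1 := by
    unfold norm1
    rw [Finset.sum_eq_single ⟨0, hd⟩]
    · simp [he]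
    · intro b _ hb; simp [he, hb]
    · simp
  have hs : {ω : Config d | ω ((0, 0), e) = true} ⊆ {ω | ∃ y, Connected ω 0 0 y 1} := by
    intro ω h
    exact ⟨e, (conn_succ ω 0 0 e 0 le_rfl).2 ⟨0, (conn_self _ _ _ _).2 rfl, by simpa using hn, h⟩⟩
  refine lt_of_lt_of_le ?_ (measure_mono hs)
  have := Measure.infinitePi_map_eval (fun _ : Bond d => bern p) ((0, 0), e)
  have h2 := bern_pos p hp
  rw [← this, Measure.map_apply (measurable_pi_apply _) (by simp), ← P_eq] at h2
  exact h2

lemma theta_eq (d : ℕ) (p : ℝ) (t : ℕ) : theta d p t = (Th d p t).toReal := rfl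

lemma Th_ne_top (d : ℕ) (p : ℝ) (t : ℕ) : Th d p t ≠ ⊤ :=
  ((Th_le_one d p t).trans_lt ENNReal.one_lt_top).ne

lemma Ch_ne_top (d : ℕ) (p : ℝ) (t : ℕ) : Ch d p t ≠ ⊤ := by
  refine ((Ch_le d p t).trans_lt ?_).ne
  refine ENNReal.mul_lt_top (ENNReal.pow_lt_top ?_) (Th_ne_top d p t).lt_top
  exact_mod_cast ENNReal.natCast_lt_top (2 * t + 1)

lemma chi_eq (d : ℕ) (p : ℝ) (t : ℕ) : chi d p t = (Ch d p t).toReal := by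
  rw [Ch, ENNReal.tsum_toReal_eq (fun x => ((Ta_le_Th d p x t).trans_lt (Th_ne_top d p t).lt_top).ne)]
  rfl

lemma theta_super (d : ℕ) (p : ℝ) (s t : ℕ) : theta d p s * theta d p t ≤ theta d p (s + t) := by
  simp only [theta_eq]
  rw [← ENNReal.toReal_mul]
  exact ENNReal.toReal_mono (Th_ne_top _ _ _) (Th_super d p s t)

lemma chi_sub (d : ℕ) (p : ℝ) (s t : ℕ) : chi d p (s + t) ≤ chi d p s * chi d p t := by
  simp only [chi_eq]
  rw [← ENNReal.toReal_mul]
  exact ENNReal.toReal_mono (ENNReal.mul_ne_top (Ch_ne_top _ _ _) (Ch_ne_top _ _ _)) (Ch_sub d p s t)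

lemma theta_le_chi (d : ℕ) (p : ℝ) (t : ℕ) : theta d p t ≤ chi d p t := by
  rw [theta_eq, chi_eq]
  exact ENNReal.toReal_mono (Ch_ne_top _ _ _) (Th_le_Ch d p t)

lemma chi_le (d : ℕ) (p : ℝ) (t : ℕ) : chi d p t ≤ (2 * t + 1) ^ d * theta d p t := by
  rw [theta_eq, chi_eq]
  have h : ((2 * t + 1 : ℝ≥0∞) ^ d * Th d p t).toReal = (2 * t + 1) ^ d * (Th d p t).toReal := by
    rw [ENNReal.toReal_mul, ENNReal.toReal_pow]
    congr 2
  rw [← h]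
  refine ENNReal.toReal_mono ?_ (Ch_le d p t)
  refine ENNReal.mul_ne_top (ENNReal.pow_ne_top ?_) (Th_ne_top d p t)
  exact_mod_cast ENNReal.natCast_ne_top (2 * t + 1)

lemma theta_le_one (d : ℕ) (p : ℝ) (t : ℕ) : theta d p t ≤ 1 := by
  rw [theta_eq]
  exact ENNReal.toReal_mono ENNReal.one_ne_top (Th_le_one d p t)

lemma theta_zero (d : ℕ) (p : ℝ) : theta d p 0 = 1 := by
  have : {ω : Config d | ∃ y, Connected ω 0 0 y 0} = univ := by
    ext ω; simp [conn_self]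
  rw [theta, this]; simp

lemma theta_ge (d : ℕ) (p : ℝ) (t : ℕ) : theta d p 1 ^ t ≤ theta d p t := by
  induction t with
  | zero => simp [theta_zero]
  | succ t ih =>
    rw [pow_succ]
    exact (mul_le_mul_of_nonneg_right ih ENNReal.toReal_nonneg).trans (theta_super d p t 1)

/-- for `p ∈ (0,1)`, the limits `lim (log θ_t)/t` and `lim (log χ_t)/t`
exist in `[-∞, ∞)`, are equal, and equal `sup_{t ≥ 1} (log θ_t)/t` resp.
`inf_{t ≥ 1} (log χ_t)/t` (all in the extended reals). -/
theorem relaxation_rate_exists (d : ℕ) (hd : 1 ≤ d) (p : ℝ) (hp : p ∈ Set.Ioo (0 : ℝ) 1) :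
    ∃ L : EReal, L < ⊤ ∧
      Filter.Tendsto (fun t : ℕ => ((Real.log (theta d p t) / t : ℝ) : EReal))
        Filter.atTop (nhds L) ∧
      Filter.Tendsto (fun t : ℕ => ((Real.log (chi d p t) / t : ℝ) : EReal))
        Filter.atTop (nhds L) ∧
      (L = ⨆ t : ℕ, ⨆ _ : 1 ≤ t, ((Real.log (theta d p t) / t : ℝ) : EReal)) ∧
      (L = ⨅ t : ℕ, ⨅ _ : 1 ≤ t, ((Real.log (chi d p t) / t : ℝ) : EReal)) := by
  have h1 : 0 < theta d p 1 := by
    rw [theta_eq]; exact ENNReal.toReal_pos (Th_one_pos d hd p hp).ne' (Th_ne_top _ _ _)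
  have hθ : ∀ t, 0 < theta d p t := fun t => (pow_pos h1 t).trans_le (theta_ge d p t)
  have hχ : ∀ t, 0 < chi d p t := fun t => (hθ t).trans_le (theta_le_chi d p t)
  have sθ : Subadditive (fun t => -Real.log (theta d p t)) := by
    intro s t
    have := Real.log_le_log (mul_pos (hθ s) (hθ t)) (theta_super d p s t)
    rw [Real.log_mul (hθ s).ne' (hθ t).ne'] at this
    linarith
  have sχ : Subadditive (fun t => Real.log (chi d p t)) := by
    intro s t
    have := Real.log_le_log (hχ (s + t)) (chi_sub d p s t)
    rwa [Real.log_mul (hχ s).ne' (hχ t).ne'] at this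
  have bθ : BddBelow (range fun n : ℕ => -Real.log (theta d p n) / n) := by
    refine ⟨0, ?_⟩
    rintro _ ⟨n, rfl⟩
    exact div_nonneg (neg_nonneg.2 (Real.log_nonpos (hθ n).le (theta_le_one d p n)))
      (Nat.cast_nonneg n)
  have bχ : BddBelow (range fun n : ℕ => Real.log (chi d p n) / n) := by
    refine ⟨Real.log (theta d p 1), ?_⟩
    rintro _ ⟨n, rfl⟩
    rcases Nat.eq_zero_or_pos n with rfl | hn
    · simpa using Real.log_nonpos h1.le (theta_le_one d p 1)
    · have hn' : (0:ℝ) < n := Nat.cast_pos.2 hn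
      have := Real.log_le_log (pow_pos h1 n) ((theta_ge d p n).trans (theta_le_chi d p n))
      rw [Real.log_pow] at this
      show _ ≤ _ / _
      rw [le_div_iff₀ hn']
      linarith
  have tθ : Tendsto (fun t : ℕ => Real.log (theta d p t) / t) atTop (𝓝 (-sθ.lim)) := by
    have := (sθ.tendsto_lim bθ).neg
    simpa [neg_div] using this
  have tχ := sχ.tendsto_lim bχ
  have t0 : Tendsto (fun t : ℕ => d * (Real.log (2 * t + 1) / t)) atTop (𝓝 0) := by
    have a : Tendsto (fun x : ℝ => Real.log x / (2⁻¹ * x + (-2⁻¹))) atTop (𝓝 0) := by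
      simpa using Real.tendsto_pow_log_div_mul_add_atTop (2⁻¹) (-2⁻¹) 1 (by norm_num)
    have b : Tendsto (fun t : ℕ => (2 * t + 1 : ℝ)) atTop atTop :=
      tendsto_atTop_add_const_right _ _
        (tendsto_natCast_atTop_atTop.const_mul_atTop (by norm_num))
    have c := (a.comp b).const_mul (d : ℝ)
    rw [mul_zero] at c
    refine c.congr fun t => ?_
    simp only [Function.comp]
    congr 2; ring
  have hdiff : Tendsto (fun t : ℕ => Real.log (chi d p t) / t - Real.log (theta d p t) / t)
      atTop (𝓝 0) := by
    refine squeeze_zero (fun t => ?_) (fun t => ?_) t0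
    · rw [← sub_div]
      exact div_nonneg (sub_nonneg.2 (Real.log_le_log (hθ t) (theta_le_chi d p t)))
        (Nat.cast_nonneg t)
    · rw [← sub_div, ← mul_div_assoc]
      refine div_le_div_of_nonneg_right ?_ (Nat.cast_nonneg t)
      have := Real.log_le_log (hχ t) (chi_le d p t)
      rw [Real.log_mul (by positivity) (hθ t).ne', Real.log_pow] at this
      linarith
  have hL : sχ.lim = -sθ.lim := by
    have := tendsto_nhds_unique hdiff (tχ.sub tθ)
    linarith
  rw [hL] at tχ
  have eθ : Tendsto (fun t : ℕ => ((Real.log (theta d p t) / t : ℝ) : EReal)) atTop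
      (𝓝 ((-sθ.lim : ℝ) : EReal)) := (continuous_coe_real_ereal.tendsto _).comp tθ
  have eχ : Tendsto (fun t : ℕ => ((Real.log (chi d p t) / t : ℝ) : EReal)) atTop
      (𝓝 ((-sθ.lim : ℝ) : EReal)) := (continuous_coe_real_ereal.tendsto _).comp tχ
  refine ⟨((-sθ.lim : ℝ) : EReal), EReal.coe_lt_top _, eθ, eχ, ?_, ?_⟩
  · refine le_antisymm (le_of_tendsto eθ ?_) ?_
    · filter_upwards [eventually_ge_atTop 1] with t ht
      exact le_iSup₂_of_le t ht le_rfl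
    · refine iSup₂_le fun t ht => EReal.coe_le_coe_iff.2 ?_
      have := sθ.lim_le_div bθ (n := t) (by omega)
      rw [neg_div] at this
      linarith
  · refine le_antisymm ?_ (ge_of_tendsto eχ ?_)
    · refine le_iInf₂ fun t ht => EReal.coe_le_coe_iff.2 ?_
      rw [← hL]
      exact sχ.lim_le_div bχ (n := t) (by omega)
    · filter_upwards [eventually_ge_atTop 1] with t ht
      exact iInf₂_le_of_le t ht le_rfl

end OrientedPercolation
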